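/- Let K be a finite pseudo-reflection group on ℝⁿ, S the full polynomial ring, I the invariant ring, and H the space of K-harmonic polynomials. Then the multiplication map j ⊗ h ↦ jh extends to a linear bijection from I ⊗ H onto S. -/

import Mathlib

open Matrix MvPolynomial Polynomial

noncomputable section

/-- `M ∈ O(n)` is a pseudo-reflection: exactly one complex eigenvalue (with
multiplicity) differs from `1`. -/
def IsPseudoReflection {n : ℕ} (M : Matrix.orthogonalGroup (Fin n) ℝ) : Prop :=
  ∃ c : ℂ, c ≠ 1 ∧
    ((M : Matrix (Fin n) (Fin n) ℝ).map (Complex.ofReal)).charpoly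
      = (Polynomial.X - Polynomial.C c) * (Polynomial.X - 1) ^ (n - 1)

/-- Action of `g ∈ O(n)` on polynomials: `(g·P)(x) = P(g⁻¹x)`. -/
def orthAct {n : ℕ} (g : Matrix.orthogonalGroup (Fin n) ℝ) :
    MvPolynomial (Fin n) ℂ →ₐ[ℂ] MvPolynomial (Fin n) ℂ :=
  aeval (fun i => ∑ j, (((((g⁻¹ : Matrix.orthogonalGroup (Fin n) ℝ) :
    Matrix (Fin n) (Fin n) ℝ) i j : ℝ) : ℂ)) • (X j : MvPolynomial (Fin n) ℂ))

/-- The submodule of `K`-invariant polynomials. -/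
def orthInv {n : ℕ} (K : Subgroup (Matrix.orthogonalGroup (Fin n) ℝ)) :
    Submodule ℂ (MvPolynomial (Fin n) ℂ) :=
  ⨅ g : K, LinearMap.ker
    ((orthAct (g : Matrix.orthogonalGroup (Fin n) ℝ)).toLinearMap - LinearMap.id)

/-- The constant-coefficient differential operator on polynomials associated to
`P ∈ ℂ[x₁,…,xₙ]` (substituting `∂/∂xᵢ` for `xᵢ`). -/
def polyDiffOp {n : ℕ} (P : MvPolynomial (Fin n) ℂ) :
    Module.End ℂ (MvPolynomial (Fin n) ℂ) :=
  ∑ α ∈ P.support, P.coeff α •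
    ((List.finRange n).foldr
      (fun i E => (((pderiv i).toLinearMap :
        Module.End ℂ (MvPolynomial (Fin n) ℂ)) ^ (α i)) * E) 1)

/-- The submodule of `K`-harmonic polynomials: those annihilated by `∂(P)` for every
`K`-invariant polynomial `P` with zero constant term. -/
def harmonicSubmodule {n : ℕ} (K : Subgroup (Matrix.orthogonalGroup (Fin n) ℝ)) :
    Submodule ℂ (MvPolynomial (Fin n) ℂ) :=
  ⨅ P ∈ {P : MvPolynomial (Fin n) ℂ | P ∈ orthInv K ∧ P.coeff 0 = 0},
    LinearMap.ker (polyDiffOp P)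

open TensorProduct

abbrev Dop {n : ℕ} (i : Fin n) : Module.End ℂ (MvPolynomial (Fin n) ℂ) := (pderiv i).toLinearMap

def Dl {n : ℕ} (l : List (Fin n)) (α : Fin n →₀ ℕ) : Module.End ℂ (MvPolynomial (Fin n) ℂ) :=
  l.foldr (fun i E => (Dop i ^ (α i)) * E) 1

lemma Dl_cons {n : ℕ} (i : Fin n) (l : List (Fin n)) (α : Fin n →₀ ℕ) :
    Dl (i :: l) α = Dop i ^ (α i) * Dl l α := rfl

lemma Dop_commute {n : ℕ} (i j : Fin n) : Commute (Dop i) (Dop j) := by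
  apply LinearMap.ext
  intro p
  ext m
  simp only [Module.End.mul_apply, Derivation.coeFn_coe, coeff_pderiv]
  by_cases h : i = j
  · subst h; rfl
  · simp [h, Ne.symm h]
    rw [add_right_comm]; ring

lemma Dop_Dl_commute {n : ℕ} (i : Fin n) (l : List (Fin n)) (α : Fin n →₀ ℕ) :
    Commute (Dop i) (Dl l α) := by
  induction l with
  | nil => exact Commute.one_right _
  | cons j l ih => exact ((Dop_commute i j).pow_right _).mul_right ih

lemma Dl_add {n : ℕ} (l : List (Fin n)) (α β : Fin n →₀ ℕ) :
    Dl l (α + β) = Dl l α * Dl l β := by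
  induction l with
  | nil => simp [Dl]
  | cons j l ih =>
    rw [Dl_cons, Dl_cons, Dl_cons, ih, Finsupp.add_apply, pow_add]
    have := ((Dop_Dl_commute j l α).pow_left (β j)).eq
    simp only [mul_assoc]
    rw [← mul_assoc (Dl l α), ← this, mul_assoc]

lemma coeff_Dop_pow {n : ℕ} (i : Fin n) (k : ℕ) (p : MvPolynomial (Fin n) ℂ) (m : Fin n →₀ ℕ) :
    coeff m ((Dop i ^ k) p) = coeff (m + Finsupp.single i k) p * ((m i + 1).ascFactorial k : ℕ) := by
  induction k generalizing m with
  | zero => simp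
  | succ k ih =>
    rw [pow_succ', Module.End.mul_apply, Derivation.coeFn_coe, coeff_pderiv, ih, add_assoc,
      ← Finsupp.single_add, add_comm 1 k, mul_assoc]
    congr 1
    simp only [Finsupp.add_apply, Finsupp.single_eq_same]
    have h := Nat.succ_ascFactorial (m i + 1) k
    have h2 : (m i + 1).ascFactorial (k + 1) = (m i + 1 + 1).ascFactorial k * (m i + 1) := by
      rw [Nat.ascFactorial_succ, ← h, mul_comm]
    rw [h2]; push_cast; ring

lemma coeff_Dl {n : ℕ} (l : List (Fin n)) (hl : l.Nodup) (α : Fin n →₀ ℕ)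
    (p : MvPolynomial (Fin n) ℂ) (m : Fin n →₀ ℕ) (hm : ∀ i ∈ l, m i = 0) :
    coeff m (Dl l α p) = coeff (m + (l.map fun i => Finsupp.single i (α i)).sum) p *
      ((l.map fun i => (α i).factorial).prod : ℕ) := by
  induction l generalizing m with
  | nil => simp [Dl]
  | cons j l ih =>
    rw [List.nodup_cons] at hl
    rw [Dl_cons, Module.End.mul_apply, coeff_Dop_pow, ih hl.2, hm j (by simp)]
    · simp only [List.map_cons, List.sum_cons, List.prod_cons, zero_add, Nat.one_ascFactorial]
      rw [add_assoc]; push_cast; ring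
    · intro i hi
      have : j ≠ i := fun h => hl.1 (h ▸ hi)
      simp [hm i (by simp [hi]), this]

def fct {n : ℕ} (α : Fin n →₀ ℕ) : ℕ := ((List.finRange n).map fun i => (α i).factorial).prod

lemma fct_pos {n : ℕ} (α : Fin n →₀ ℕ) : 0 < fct α := by
  apply List.prod_pos
  simp [Nat.factorial_pos]

lemma coeff_zero_D {n : ℕ} (α : Fin n →₀ ℕ) (p : MvPolynomial (Fin n) ℂ) :
    coeff 0 (Dl (List.finRange n) α p) = coeff α p * (fct α : ℂ) := by
  rw [coeff_Dl _ (List.nodup_finRange n) _ _ _ (by simp), zero_add]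
  congr 2
  rw [← List.ofFn_eq_map, List.sum_ofFn]
  exact Finsupp.univ_sum_single α

def DL {n : ℕ} : MvPolynomial (Fin n) ℂ →ₗ[ℂ] Module.End ℂ (MvPolynomial (Fin n) ℂ) :=
  (basisMonomials (Fin n) ℂ).constr ℂ (fun α => Dl (List.finRange n) α)

lemma DL_monomial {n : ℕ} (α : Fin n →₀ ℕ) :
    DL (monomial α 1) = Dl (List.finRange n) α := by
  rw [DL, show monomial α (1:ℂ) = MvPolynomial.basisMonomials (Fin n) ℂ α by simp,
    Module.Basis.constr_basis]

lemma DL_eq {n : ℕ} (P : MvPolynomial (Fin n) ℂ) : DL P = polyDiffOp P := by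
  conv_lhs => rw [P.as_sum]
  rw [map_sum, polyDiffOp]
  refine Finset.sum_congr rfl fun α _ => ?_
  have : monomial α (coeff α P) = coeff α P • monomial α (1:ℂ) := by simp [MvPolynomial.smul_monomial]
  rw [this, map_smul, DL_monomial]; rfl

lemma DL_mul {n : ℕ} (P Q : MvPolynomial (Fin n) ℂ) : DL (P * Q) = DL P * DL Q := by
  have : (LinearMap.mul ℂ (MvPolynomial (Fin n) ℂ)).compr₂ DL
      = (LinearMap.mul ℂ (Module.End ℂ (MvPolynomial (Fin n) ℂ))).compl₁₂ DL DL := by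
    apply (basisMonomials (Fin n) ℂ).ext
    intro α
    apply (basisMonomials (Fin n) ℂ).ext
    intro β
    simp [monomial_mul, DL_monomial, Dl_add]
  exact congrArg (fun f => f P Q) this

def BF {n : ℕ} : LinearMap.BilinForm ℂ (MvPolynomial (Fin n) ℂ) :=
  DL.compr₂ (lcoeff ℂ 0)

lemma BF_apply {n : ℕ} (P Q : MvPolynomial (Fin n) ℂ) : BF P Q = coeff 0 (DL P Q) := rfl

lemma BF_eq {n : ℕ} (P Q : MvPolynomial (Fin n) ℂ) :
    BF P Q = ∑ α ∈ P.support, coeff α P * coeff α Q * (fct α : ℂ) := by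
  conv_lhs => rw [P.as_sum]
  rw [map_sum, LinearMap.sum_apply]
  refine Finset.sum_congr rfl fun α _ => ?_
  have : monomial α (coeff α P) = coeff α P • monomial α (1:ℂ) := by simp [MvPolynomial.smul_monomial]
  rw [this, map_smul, LinearMap.smul_apply, BF_apply, DL_monomial, coeff_zero_D]
  simp [mul_assoc]

lemma BF_eq_of_subset {n : ℕ} (P Q : MvPolynomial (Fin n) ℂ) (s : Finset (Fin n →₀ ℕ))
    (hs : P.support ⊆ s) :
    BF P Q = ∑ α ∈ s, coeff α P * coeff α Q * (fct α : ℂ) := by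
  rw [BF_eq]
  apply Finset.sum_subset hs
  intro α _ h
  simp [notMem_support_iff.1 h]

lemma BF_symm {n : ℕ} (P Q : MvPolynomial (Fin n) ℂ) : BF P Q = BF Q P := by
  classical
  rw [BF_eq_of_subset P Q _ Finset.subset_union_left,
    BF_eq_of_subset Q P _ (Finset.subset_union_right (s₁ := P.support))]
  refine Finset.sum_congr rfl fun α _ => by ring

abbrev cj {n : ℕ} : MvPolynomial (Fin n) ℂ →+* MvPolynomial (Fin n) ℂ :=
  MvPolynomial.map (starRingEnd ℂ)

lemma BF_pos {n : ℕ} (P : MvPolynomial (Fin n) ℂ) (h : BF P (cj P) = 0) : P = 0 := by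
  rw [BF_eq] at h
  have h2 : ∑ α ∈ P.support, ‖coeff α P‖ ^ 2 * (fct α : ℝ) = 0 := by
    have : ((∑ α ∈ P.support, ‖coeff α P‖ ^ 2 * (fct α : ℝ) : ℝ) : ℂ) = 0 := by
      rw [← h]; push_cast
      refine Finset.sum_congr rfl fun α _ => ?_
      rw [MvPolynomial.coeff_map, Complex.mul_conj']
    exact_mod_cast this
  rw [Finset.sum_eq_zero_iff_of_nonneg (fun _ _ => by positivity)] at h2
  ext α
  by_cases hα : α ∈ P.support
  · have := h2 α hα
    have hp := fct_pos α
    simpa [hp.ne'] using this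
  · simpa using hα

/-- if all pairings vanish then zero -/
lemma BF_nondeg {n : ℕ} (Q : MvPolynomial (Fin n) ℂ) (h : ∀ α, BF (monomial α 1) Q = 0) :
    Q = 0 := by
  ext α
  have := h α
  rw [BF_apply, DL_monomial, coeff_zero_D] at this
  simpa [(fct_pos α).ne'] using this

lemma BF_homog {n d e : ℕ} (P Q : MvPolynomial (Fin n) ℂ) (hP : P.IsHomogeneous d)
    (hQ : Q.IsHomogeneous e) (h : d ≠ e) : BF P Q = 0 := by
  rw [BF_eq]
  refine Finset.sum_eq_zero fun α _ => ?_
  by_cases hd : α.degree = d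
  · rw [hQ.coeff_eq_zero (d := α) (by rwa [hd])]; simp
  · rw [hP.coeff_eq_zero hd]; simp

lemma BF_comp {n d : ℕ} (P Q : MvPolynomial (Fin n) ℂ) (hQ : Q.IsHomogeneous d) :
    BF P Q = BF (homogeneousComponent d P) Q := by
  rw [BF_eq, BF_eq_of_subset (homogeneousComponent d P) Q P.support]
  · refine Finset.sum_congr rfl fun α _ => ?_
    rw [coeff_homogeneousComponent]
    split_ifs with h
    · rfl
    · rw [hQ.coeff_eq_zero h]; simp
  · rw [support_homogeneousComponent]; exact Finset.filter_subset _ _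

section act
variable {n : ℕ}

lemma orthAct_X (g : Matrix.orthogonalGroup (Fin n) ℝ) (i : Fin n) :
    orthAct g (X i) = ∑ j, (((((g⁻¹ : Matrix.orthogonalGroup (Fin n) ℝ) :
    Matrix (Fin n) (Fin n) ℝ) i j : ℝ) : ℂ)) • (X j : MvPolynomial (Fin n) ℂ) := by
  simp [orthAct]

lemma orthAct_one : orthAct (1 : Matrix.orthogonalGroup (Fin n) ℝ) = AlgHom.id ℂ _ := by
  apply MvPolynomial.algHom_ext
  intro i
  rw [orthAct_X]
  simp [Matrix.one_apply, ite_smul]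

lemma orthAct_mul (g h : Matrix.orthogonalGroup (Fin n) ℝ) :
    orthAct (g * h) = (orthAct g).comp (orthAct h) := by
  apply MvPolynomial.algHom_ext
  intro i
  rw [AlgHom.comp_apply, orthAct_X, orthAct_X, map_sum]
  simp only [map_smul, orthAct_X, Finset.smul_sum, smul_smul]
  rw [Finset.sum_comm]
  refine Finset.sum_congr rfl fun j _ => ?_
  rw [← Finset.sum_smul, _root_.mul_inv_rev, Submonoid.coe_mul, Matrix.mul_apply]
  push_cast
  rfl

lemma orthAct_mul_apply (g h : Matrix.orthogonalGroup (Fin n) ℝ) (p : MvPolynomial (Fin n) ℂ) :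
    orthAct (g * h) p = orthAct g (orthAct h p) := by rw [orthAct_mul]; rfl

lemma orthAct_homog (g : Matrix.orthogonalGroup (Fin n) ℝ) {d : ℕ} {p : MvPolynomial (Fin n) ℂ}
    (hp : p.IsHomogeneous d) : (orthAct g p).IsHomogeneous d := by
  have := hp.aeval (fun i => ∑ j, (((((g⁻¹ : Matrix.orthogonalGroup (Fin n) ℝ) :
    Matrix (Fin n) (Fin n) ℝ) i j : ℝ) : ℂ)) • (X j : MvPolynomial (Fin n) ℂ)) (n := 1) (by
      intro i
      apply IsHomogeneous.sum
      intro j _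
      rw [MvPolynomial.smul_eq_C_mul]
      exact isHomogeneous_C_mul_X _ _)
  rw [one_mul] at this
  exact this

lemma hc_finsum (d : ℕ) (s : Finset ℕ) (f : ℕ → MvPolynomial (Fin n) ℂ)
    (hf : ∀ k, (f k).IsHomogeneous k) :
    homogeneousComponent d (∑ k ∈ s, f k) = if d ∈ s then f d else 0 := by
  rw [map_sum]
  have : ∀ k ∈ s, homogeneousComponent d (f k) = if d = k then f k else 0 := by
    intro k _
    rw [homogeneousComponent_of_mem (hf k)]
  rw [Finset.sum_congr rfl this, Finset.sum_ite_eq]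

lemma orthAct_hc (g : Matrix.orthogonalGroup (Fin n) ℝ) (d : ℕ) (p : MvPolynomial (Fin n) ℂ) :
    orthAct g (homogeneousComponent d p) = homogeneousComponent d (orthAct g p) := by
  conv_rhs => rw [← sum_homogeneousComponent p, map_sum,
    hc_finsum _ _ _ (fun k => orthAct_homog g (homogeneousComponent_isHomogeneous k p))]
  split_ifs with h
  · rfl
  · rw [homogeneousComponent_eq_zero _ _ (by simpa using h), map_zero]

lemma orthAct_totalDegree (g : Matrix.orthogonalGroup (Fin n) ℝ) (p : MvPolynomial (Fin n) ℂ) :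
    (orthAct g p).totalDegree ≤ p.totalDegree := by
  conv_lhs => rw [← sum_homogeneousComponent p, map_sum]
  apply totalDegree_finsetSum_le
  intro k hk
  refine (orthAct_homog g (homogeneousComponent_isHomogeneous k p)).totalDegree_le.trans ?_
  simpa [Nat.lt_succ_iff] using hk

lemma orthAct_coeff_zero (g : Matrix.orthogonalGroup (Fin n) ℝ) (p : MvPolynomial (Fin n) ℂ) :
    coeff 0 (orthAct g p) = coeff 0 p := by
  have := orthAct_hc g 0 p
  rw [homogeneousComponent_zero, homogeneousComponent_zero, ← MvPolynomial.algebraMap_eq,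
    AlgHom.commutes, MvPolynomial.algebraMap_eq] at this
  exact (MvPolynomial.C_injective _ _ this).symm

lemma orthAct_cj (g : Matrix.orthogonalGroup (Fin n) ℝ) (p : MvPolynomial (Fin n) ℂ) :
    orthAct g (cj p) = cj (orthAct g p) := by
  have : ((orthAct g : MvPolynomial (Fin n) ℂ →ₐ[ℂ] _) : MvPolynomial (Fin n) ℂ →+* _).comp cj
      = cj.comp ((orthAct g : MvPolynomial (Fin n) ℂ →ₐ[ℂ] MvPolynomial (Fin n) ℂ) :
        MvPolynomial (Fin n) ℂ →+* MvPolynomial (Fin n) ℂ) := by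
    apply MvPolynomial.ringHom_ext
    · intro r
      simp [← MvPolynomial.algebraMap_eq]
    · intro i
      simp [orthAct_X, MvPolynomial.smul_eq_C_mul]
  exact congrArg (fun f => f p) this

variable (K : Subgroup (Matrix.orthogonalGroup (Fin n) ℝ))

lemma mem_orthInv {p : MvPolynomial (Fin n) ℂ} :
    p ∈ orthInv K ↔ ∀ g ∈ K, orthAct g p = p := by
  simp [orthInv, Submodule.mem_iInf, sub_eq_zero]

def Iplus : Submodule ℂ (MvPolynomial (Fin n) ℂ) :=
  orthInv K ⊓ LinearMap.ker (lcoeff ℂ 0)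

lemma mem_Iplus {p : MvPolynomial (Fin n) ℂ} :
    p ∈ Iplus K ↔ p ∈ orthInv K ∧ coeff 0 p = 0 := by
  simp [Iplus]

def JJ : Submodule ℂ (MvPolynomial (Fin n) ℂ) := ⊤ * Iplus K

lemma mem_harm {h : MvPolynomial (Fin n) ℂ} :
    h ∈ harmonicSubmodule K ↔ ∀ P ∈ Iplus K, DL P h = 0 := by
  simp [harmonicSubmodule, Submodule.mem_iInf, mem_Iplus, DL_eq]

lemma Iplus_le_JJ : Iplus K ≤ JJ K := by
  intro p hp
  have := Submodule.mul_mem_mul (Submodule.mem_top (R := ℂ) (x := (1 : MvPolynomial (Fin n) ℂ))) hp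
  rwa [one_mul] at this

lemma mul_mem_JJ (q : MvPolynomial (Fin n) ℂ) {p : MvPolynomial (Fin n) ℂ} (hp : p ∈ JJ K) :
    q * p ∈ JJ K := by
  induction hp using Submodule.mul_induction_on' with
  | mem_mul_mem a _ b hb =>
    rw [← mul_assoc]; exact Submodule.mul_mem_mul Submodule.mem_top hb
  | add x _ y _ hx hy => rw [mul_add]; exact add_mem hx hy

lemma Iplus_hc (d : ℕ) {p : MvPolynomial (Fin n) ℂ} (hp : p ∈ Iplus K) :
    homogeneousComponent d p ∈ Iplus K := by
  rw [mem_Iplus, mem_orthInv] at *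
  refine ⟨fun g hg => by rw [orthAct_hc, hp.1 g hg], ?_⟩
  rw [coeff_homogeneousComponent, hp.2]; simp

lemma Iplus_cj {p : MvPolynomial (Fin n) ℂ} (hp : p ∈ Iplus K) : cj p ∈ Iplus K := by
  rw [mem_Iplus, mem_orthInv] at *
  refine ⟨fun g hg => by rw [orthAct_cj, hp.1 g hg], ?_⟩
  rw [MvPolynomial.coeff_map, hp.2]; simp

lemma JJ_cj {p : MvPolynomial (Fin n) ℂ} (hp : p ∈ JJ K) : cj p ∈ JJ K := by
  induction hp using Submodule.mul_induction_on' with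
  | mem_mul_mem a _ b hb =>
    rw [map_mul]; exact Submodule.mul_mem_mul Submodule.mem_top (Iplus_cj K hb)
  | add x _ y _ hx hy => rw [map_add]; exact add_mem hx hy

lemma JJ_act {g : Matrix.orthogonalGroup (Fin n) ℝ} (hg : g ∈ K) {p : MvPolynomial (Fin n) ℂ}
    (hp : p ∈ JJ K) : orthAct g p ∈ JJ K := by
  induction hp using Submodule.mul_induction_on' with
  | mem_mul_mem a _ b hb =>
    rw [map_mul, (mem_orthInv K).1 ((mem_Iplus K).1 hb).1 g hg]
    exact Submodule.mul_mem_mul Submodule.mem_top hb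
  | add x _ y _ hx hy => rw [map_add]; exact add_mem hx hy

lemma hc_mul_homog {d e : ℕ} {q p : MvPolynomial (Fin n) ℂ} (hq : q.IsHomogeneous e) :
    homogeneousComponent d (q * p) =
      if e ≤ d then q * homogeneousComponent (d - e) p else 0 := by
  conv_lhs => rw [← sum_homogeneousComponent p, Finset.mul_sum, map_sum]
  have : ∀ k ∈ Finset.range (p.totalDegree + 1),
      homogeneousComponent d (q * homogeneousComponent k p) =
      if d = e + k then q * homogeneousComponent k p else 0 := by
    intro k _
    rw [homogeneousComponent_of_mem (hq.mul (homogeneousComponent_isHomogeneous k p))]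
  rw [Finset.sum_congr rfl this]
  split_ifs with h
  · obtain ⟨k, rfl⟩ := Nat.exists_eq_add_of_le h
    simp only [Nat.add_left_cancel_iff, Finset.sum_ite_eq, Nat.add_sub_cancel_left]
    split_ifs with h2
    · rfl
    · rw [homogeneousComponent_eq_zero _ _ (by simpa using h2), mul_zero]
  · apply Finset.sum_eq_zero
    intro k _
    rw [if_neg (by omega)]

lemma JJ_hc (d : ℕ) (M : Submodule ℂ (MvPolynomial (Fin n) ℂ))
    (hM : ∀ e < d, ∀ q : MvPolynomial (Fin n) ℂ, q.IsHomogeneous e → ∀ p ∈ Iplus K, q * p ∈ M)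
    {a : MvPolynomial (Fin n) ℂ} (ha : a ∈ JJ K) : homogeneousComponent d a ∈ M := by
  induction ha using Submodule.mul_induction_on' with
  | mem_mul_mem a _ b hb =>
    rw [← sum_homogeneousComponent a, Finset.sum_mul, map_sum]
    refine Submodule.sum_mem _ fun e _ => ?_
    rw [hc_mul_homog (homogeneousComponent_isHomogeneous e a)]
    split_ifs with h
    · rcases h.lt_or_eq with h | h
      · exact hM e h _ (homogeneousComponent_isHomogeneous e a) _ (Iplus_hc K _ hb)
      · subst h
        rw [Nat.sub_self, homogeneousComponent_zero, ((mem_Iplus K).1 hb).2]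
        simp
    · exact zero_mem _
  | add x _ y _ hx hy => rw [map_add]; exact add_mem hx hy

lemma JJ_hc' (d : ℕ) {a : MvPolynomial (Fin n) ℂ} (ha : a ∈ JJ K) :
    homogeneousComponent d a ∈ JJ K :=
  JJ_hc K d _ (fun _ _ _ _ _ hp => Submodule.mul_mem_mul Submodule.mem_top hp) ha

lemma harm_inf_JJ {h : MvPolynomial (Fin n) ℂ} (hh : h ∈ harmonicSubmodule K)
    (hJ : h ∈ JJ K) : h = 0 := by
  have key : ∀ a ∈ JJ K, DL a h = 0 := by
    intro a ha
    induction ha using Submodule.mul_induction_on' with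
    | mem_mul_mem a _ b hb =>
      rw [DL_mul, Module.End.mul_apply, (mem_harm K).1 hh b hb, map_zero]
    | add x _ y _ hx hy => rw [map_add, LinearMap.add_apply, hx, hy, add_zero]
  apply BF_pos
  rw [BF_symm, BF_apply, key _ (JJ_cj K hJ)]
  simp

lemma homog_decomp {d : ℕ} {p : MvPolynomial (Fin n) ℂ} (hp : p.IsHomogeneous d) :
    ∃ a ∈ JJ K, a.IsHomogeneous d ∧ p - a ∈ harmonicSubmodule K := by
  let V := homogeneousSubmodule (Fin n) ℂ d
  have hfd : FiniteDimensional ℂ V :=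
    Module.Finite.iff_fg.2 (homogeneousSubmodule_fg _ _ d)
  let W : Submodule ℂ V := (JJ K).comap V.subtype
  let B : LinearMap.BilinForm ℂ V := BF.restrict V
  have hrefl : B.IsRefl := by
    intro x y h
    change BF (y : MvPolynomial (Fin n) ℂ) x = 0
    rw [BF_symm]; exact h
  have hdis : Disjoint W (B.orthogonal W) := by
    rw [Submodule.disjoint_def]
    intro x hx hx2
    apply Subtype.ext
    apply BF_pos
    have := hx2 ⟨cj x, IsHomogeneous.map x.2 _⟩ (JJ_cj K hx)
    rw [BF_symm]
    exact this
  have hc := (LinearMap.BilinForm.isCompl_orthogonal_iff_disjoint hrefl).2 hdis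
  have hpt : (⟨p, hp⟩ : V) ∈ W ⊔ B.orthogonal W := by rw [hc.sup_eq_top]; trivial
  obtain ⟨a, ha, h, hh, hah⟩ := Submodule.mem_sup.1 hpt
  have hp' : p = a + h := (congrArg Subtype.val hah).symm
  refine ⟨a, ha, a.2, ?_⟩
  rw [hp', add_sub_cancel_left, mem_harm]
  intro P hP
  apply BF_nondeg
  intro α
  rw [BF_apply, ← Module.End.mul_apply, ← DL_mul, ← BF_apply, BF_comp _ _ h.2]
  exact hh ⟨_, homogeneousComponent_isHomogeneous d _⟩
    (JJ_hc' K d (Submodule.mul_mem_mul Submodule.mem_top hP))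

lemma one_mem_orthInv : (1 : MvPolynomial (Fin n) ℂ) ∈ orthInv K := by
  rw [mem_orthInv]; simp

lemma mul_mem_orthInv {p q : MvPolynomial (Fin n) ℂ} (hp : p ∈ orthInv K) (hq : q ∈ orthInv K) :
    p * q ∈ orthInv K := by
  rw [mem_orthInv] at *
  intro g hg
  rw [map_mul, hp g hg, hq g hg]

lemma homog_mem (d : ℕ) : ∀ p : MvPolynomial (Fin n) ℂ, p.IsHomogeneous d →
    p ∈ orthInv K * harmonicSubmodule K := by
  induction d using Nat.strong_induction_on with
  | _ d ih =>
    intro p hp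
    obtain ⟨a, haJ, had, hh⟩ := homog_decomp K hp
    have h1 : a ∈ orthInv K * harmonicSubmodule K := by
      rw [← homogeneousComponent_eq_self had]
      refine JJ_hc K d _ ?_ haJ
      intro e he q hq b hb
      have := ih e he q hq
      have hb := ((mem_Iplus K).1 hb).1
      clear hq
      induction this using Submodule.mul_induction_on' with
      | mem_mul_mem x hx y hy =>
        rw [mul_comm (x * y), ← mul_assoc]
        exact Submodule.mul_mem_mul (mul_mem_orthInv K hb hx) hy
      | add x _ y _ hx hy => rw [add_mul]; exact add_mem hx hy
    have h2 := Submodule.mul_mem_mul (one_mem_orthInv K) hh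
    rw [one_mul] at h2
    simpa using add_mem h1 h2

lemma surj_mul : orthInv K * harmonicSubmodule K = ⊤ := by
  rw [eq_top_iff]
  intro p _
  rw [← sum_homogeneousComponent p]
  exact Submodule.sum_mem _ fun d _ => homog_mem K d _ (homogeneousComponent_isHomogeneous d p)

end act

section refl
variable {n : ℕ}

open scoped ComplexOrder in
lemma pow_kill (M : Matrix (Fin n) (Fin n) ℂ) (h1 : M * Mᴴ = 1) (h2 : Mᴴ * M = 1)
    (k : ℕ) (A : Matrix (Fin n) (Fin n) ℂ) (h : (M - 1) ^ k * A = 0) : (M - 1) * A = 0 := by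
  induction k with
  | zero => rw [pow_zero, one_mul] at h; rw [h, mul_zero]
  | succ k ih =>
    rcases k with _ | k
    · simpa using h
    · apply ih
      have e : (M - 1) * (M - 1) = -(M * ((M - 1)ᴴ * (M - 1))) := by
        rw [Matrix.conjTranspose_sub, Matrix.conjTranspose_one]
        have : M * ((Mᴴ - 1) * (M - 1)) = M * (Mᴴ * M) - M * Mᴴ - M * M + M := by noncomm_ring
        rw [this, h1, h2]; noncomm_ring
      have h3 : (M - 1)ᴴ * (M - 1) * ((M - 1) ^ k * A) = 0 := by
        have : M * ((M - 1)ᴴ * (M - 1) * ((M - 1) ^ k * A)) = 0 := by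
          have h' : (M - 1) * (M - 1) * ((M - 1) ^ k * A) = 0 := by
            rw [← h, pow_succ', pow_succ']; simp only [mul_assoc]
          rw [e, neg_mul, neg_eq_zero, mul_assoc] at h'
          exact h'
        calc _ = Mᴴ * M * ((M - 1)ᴴ * (M - 1) * ((M - 1) ^ k * A)) := by rw [h2, one_mul]
          _ = 0 := by rw [mul_assoc, this, mul_zero]
      rw [Matrix.conjTranspose_mul_self_mul_eq_zero] at h3
      rw [pow_succ', mul_assoc, h3]

lemma rank_one_of (M : Matrix (Fin n) (Fin n) ℂ) (h1 : M * Mᴴ = 1) (h2 : Mᴴ * M = 1)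
    (c : ℂ) (hc : c ≠ 1)
    (hchar : M.charpoly = (Polynomial.X - Polynomial.C c) * (Polynomial.X - 1) ^ (n - 1)) :
    ∃ v a : Fin n → ℂ, a ≠ 0 ∧ ∀ i j, (M - 1) i j = v i * a j := by
  have hn : n ≠ 0 := by
    rintro rfl
    have := congrArg Polynomial.natDegree hchar
    rw [Matrix.charpoly_natDegree_eq_dim] at this
    simp at this
  have hc1 : c - 1 ≠ 0 := sub_ne_zero.2 hc
  have hkill : (M - 1) * (M - Matrix.scalar _ c) = 0 := by
    apply pow_kill M h1 h2 (n - 1)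
    have := Matrix.aeval_self_charpoly M
    rw [hchar, mul_comm, map_mul, map_pow, map_sub, map_sub, Polynomial.aeval_X, map_one,
      Polynomial.aeval_C] at this
    exact this
  have hsq : (M - 1) * (M - 1) = (c - 1) • (M - 1) := by
    have e : M - 1 = (M - Matrix.scalar _ c) + (c - 1) • (1 : Matrix (Fin n) (Fin n) ℂ) := by
      rw [Matrix.scalar_apply, ← Matrix.smul_one_eq_diagonal, sub_smul, one_smul]; abel
    calc (M - 1) * (M - 1) = (M - 1) * ((M - Matrix.scalar _ c) +
          (c - 1) • (1 : Matrix (Fin n) (Fin n) ℂ)) := by rw [← e]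
      _ = _ := by rw [mul_add, hkill]; simp
  have htr : (M - 1).trace = c - 1 := by
    rw [Matrix.trace_sub, Matrix.trace_one, Matrix.trace_eq_sum_roots_charpoly, hchar,
      ← Polynomial.C_1, Polynomial.roots_mul, Polynomial.roots_pow, Polynomial.roots_X_sub_C,
      Polynomial.roots_X_sub_C]
    · obtain ⟨k, rfl⟩ := Nat.exists_eq_succ_of_ne_zero hn
      simp [Multiset.sum_nsmul]
      ring
    · exact mul_ne_zero (Polynomial.X_sub_C_ne_zero _)
        (pow_ne_zero _ (Polynomial.X_sub_C_ne_zero _))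
  let E := (c - 1)⁻¹ • (M - 1)
  have hE : IsIdempotentElem E := by
    simp only [IsIdempotentElem, E, smul_mul_smul_comm, hsq, smul_smul]
    congr 1; field_simp
  have hEt : E.trace = 1 := by
    simp only [E, Matrix.trace_smul, htr, smul_eq_mul]; field_simp
  have hL : IsIdempotentElem (Matrix.toLin' E) := by
    rw [IsIdempotentElem, Module.End.mul_eq_comp, ← Matrix.toLin'_mul, hE.eq]
  have hfr := (LinearMap.IsIdempotentElem.isProj_range _ hL).trace
  rw [Matrix.trace_toLin'_eq, hEt] at hfr
  have hfr' : Module.finrank ℂ (LinearMap.range (Matrix.toLin' E)) = 1 := by exact_mod_cast hfr.symm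
  obtain ⟨v, -, hv⟩ := finrank_eq_one_iff'.1 hfr'
  choose a ha using fun j => hv ⟨Matrix.toLin' E (Pi.single j 1), LinearMap.mem_range_self _ _⟩
  have hM : ∀ i j, (M - 1) i j = ((c - 1) * v.1 i) * a j := by
    intro i j
    have := congrFun (congrArg Subtype.val (ha j)) i
    simp [E] at this
    rw [mul_assoc, mul_comm (v.1 i), this]
    field_simp
    simp [Matrix.one_apply, Pi.single_apply]
  refine ⟨fun i => (c - 1) * v.1 i, a, ?_, hM⟩
  rintro rfl
  have : M - 1 = 0 := by ext i j; rw [hM]; simp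
  rw [this] at htr
  simp at htr
  exact hc1 htr.symm

lemma refl_form (g : Matrix.orthogonalGroup (Fin n) ℝ) (hg : IsPseudoReflection g) :
    ∃ l : MvPolynomial (Fin n) ℂ, l ≠ 0 ∧ l.IsHomogeneous 1 ∧ ∀ p, l ∣ orthAct g p - p := by
  obtain ⟨c, hc, hchar⟩ := hg
  have hstar : ∀ g : Matrix.orthogonalGroup (Fin n) ℝ,
      (((g : Matrix (Fin n) (Fin n) ℝ).map Complex.ofReal))ᴴ
      = ((g⁻¹ : Matrix.orthogonalGroup (Fin n) ℝ) : Matrix (Fin n) (Fin n) ℝ).map Complex.ofReal := by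
    intro g
    ext i j
    simp [Matrix.UnitaryGroup.inv_val, Matrix.star_apply]
  have hmul : ∀ g h : Matrix.orthogonalGroup (Fin n) ℝ,
      (g : Matrix (Fin n) (Fin n) ℝ).map Complex.ofReal *
      (h : Matrix (Fin n) (Fin n) ℝ).map Complex.ofReal =
      ((g * h : Matrix.orthogonalGroup (Fin n) ℝ) : Matrix (Fin n) (Fin n) ℝ).map
        Complex.ofReal := by
    intro g h
    exact (Matrix.map_mul (f := Complex.ofRealHom)).symm
  have hone : ((1 : Matrix.orthogonalGroup (Fin n) ℝ) : Matrix (Fin n) (Fin n) ℝ).map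
        Complex.ofReal = 1 := by
    simp
  set M := (g : Matrix (Fin n) (Fin n) ℝ).map Complex.ofReal with hMdef
  set M' := ((g⁻¹ : Matrix.orthogonalGroup (Fin n) ℝ) : Matrix (Fin n) (Fin n) ℝ).map
    Complex.ofReal with hM'
  have h2 : M' * M = 1 := by rw [hM', hmul, inv_mul_cancel, hone]
  have h1 : M * M' = 1 := by rw [hM', hmul, mul_inv_cancel, hone]
  obtain ⟨v, a, ha, hva⟩ := rank_one_of M (by rw [hstar]; exact h1) (by rw [hstar]; exact h2) c hc hchar
  refine ⟨∑ j, a j • X j, ?_, ?_, ?_⟩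
  · intro h
    apply ha
    ext j
    have := congrArg (MvPolynomial.coeff (Finsupp.single j 1)) h
    simpa [MvPolynomial.coeff_sum, MvPolynomial.coeff_X,
      Finsupp.single_left_inj (one_ne_zero : (1 : ℕ) ≠ 0)] using this
  · apply IsHomogeneous.sum
    intro j _
    rw [MvPolynomial.smul_eq_C_mul]
    exact isHomogeneous_C_mul_X _ _
  · intro p
    set l : MvPolynomial (Fin n) ℂ := ∑ j, a j • X j with hl
    have key : (Ideal.Quotient.mkₐ ℂ (Ideal.span {l})).comp (orthAct g)
        = Ideal.Quotient.mkₐ ℂ (Ideal.span {l}) := by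
      apply MvPolynomial.algHom_ext
      intro i
      rw [AlgHom.comp_apply, ← sub_eq_zero, ← map_sub]
      rw [Ideal.Quotient.mkₐ_eq_mk, Ideal.Quotient.eq_zero_iff_mem, Ideal.mem_span_singleton]
      have hM2 : ∀ j, M' i j = (1 : Matrix (Fin n) (Fin n) ℂ) i j - (M'.mulVec v) i * a j := by
        intro j
        have e : M' = 1 - M' * (M - 1) := by rw [mul_sub, h2]; simp
        conv_lhs => rw [e]
        rw [Matrix.sub_apply, Matrix.mul_apply, Matrix.mulVec, dotProduct, Finset.sum_mul]
        simp only [hva, mul_assoc]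
      have e2 : orthAct g (X i) - X i = - ((M'.mulVec v) i • l) := by
        rw [orthAct_X]
        change ∑ j, M' i j • (X j : MvPolynomial (Fin n) ℂ) - X i = _
        simp only [hM2, sub_smul, Finset.sum_sub_distrib, hl, Finset.smul_sum, smul_smul]
        simp [Matrix.one_apply, ite_smul]
      rw [e2, MvPolynomial.smul_eq_C_mul]
      exact (dvd_mul_left _ _).neg_right
    have := congrArg (fun f => f p) key
    simp only [AlgHom.comp_apply] at this
    rw [← sub_eq_zero, ← map_sub, Ideal.Quotient.mkₐ_eq_mk, Ideal.Quotient.eq_zero_iff_mem,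
      Ideal.mem_span_singleton] at this
    exact this

end refl

section chev
variable {n : ℕ} (K : Subgroup (Matrix.orthogonalGroup (Fin n) ℝ)) [Finite K]

lemma chevalley
    (hrefl : K = Subgroup.closure
      {g : Matrix.orthogonalGroup (Fin n) ℝ | g ∈ K ∧ IsPseudoReflection g})
    {ι : Type*} (s : Finset ι) (f₀ : MvPolynomial (Fin n) ℂ) (f : ι → MvPolynomial (Fin n) ℂ)
    (hf₀ : f₀ ∈ orthInv K) (hf : ∀ i, f i ∈ orthInv K)
    (hnot : ∀ u ∈ orthInv K, coeff 0 u ≠ 0 → ∀ a : ι → MvPolynomial (Fin n) ℂ,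
      (∀ i, a i ∈ orthInv K) → u * f₀ ≠ ∑ i ∈ s, a i * f i) :
    ∀ (d : ℕ) (p₀ : MvPolynomial (Fin n) ℂ) (p : ι → MvPolynomial (Fin n) ℂ),
      p₀.totalDegree < d → f₀ * p₀ + ∑ i ∈ s, f i * p i = 0 → p₀ ∈ JJ K := by
  intro d
  induction d with
  | zero => intro p₀ p h; omega
  | succ d ih =>
    intro p₀ p hd hsum
    -- reflections fix p₀ modulo the ideal
    have hr : ∀ g ∈ {g : Matrix.orthogonalGroup (Fin n) ℝ | g ∈ K ∧ IsPseudoReflection g},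
        orthAct g p₀ - p₀ ∈ JJ K := by
      rintro g ⟨hgK, hg⟩
      obtain ⟨l, hl0, hl1, hdvd⟩ := refl_form g hg
      choose q hq using hdvd
      rw [hq]
      apply mul_mem_JJ
      by_cases hq0 : q p₀ = 0
      · rw [hq0]; exact zero_mem _
      apply ih (q p₀) (fun i => q (p i))
      · have h1 : (l * q p₀).totalDegree = 1 + (q p₀).totalDegree := by
          rw [totalDegree_mul_of_isDomain hl0 hq0, hl1.totalDegree hl0]
        have h2 : (l * q p₀).totalDegree ≤ p₀.totalDegree := by
          rw [← hq]
          exact (totalDegree_sub _ _).trans (max_le (orthAct_totalDegree g p₀) le_rfl)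
        omega
      · have h3 := congrArg (orthAct g) hsum
        simp only [map_add, map_sum, map_mul, map_zero, (mem_orthInv K).1 hf₀ g hgK,
          fun i => (mem_orthInv K).1 (hf i) g hgK] at h3
        have h4 : l * (f₀ * q p₀ + ∑ i ∈ s, f i * q (p i)) = 0 := by
          rw [mul_add, Finset.mul_sum]
          have e : ∀ a b : MvPolynomial (Fin n) ℂ, l * (a * q b) = a * orthAct g b - a * b := by
            intro a b
            rw [← mul_sub, hq]; ring
          simp only [e, Finset.sum_sub_distrib]
          linear_combination h3 - hsum
        exact (mul_eq_zero.1 h4).resolve_left hl0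
    have hall : ∀ g ∈ K, orthAct g p₀ - p₀ ∈ JJ K := by
      intro g hgK
      have hg' := hgK
      rw [hrefl] at hg'
      have : g ∈ K ∧ orthAct g p₀ - p₀ ∈ JJ K := by
        induction hg' using Subgroup.closure_induction with
        | mem x hx => exact ⟨hx.1, hr x hx⟩
        | one => exact ⟨one_mem _, by rw [orthAct_one]; simp⟩
        | mul x y hx hy h1 h2 =>
          have hxK : x ∈ K := by rw [hrefl]; exact hx
          have hyK : y ∈ K := by rw [hrefl]; exact hy
          refine ⟨hgK, ?_⟩
          have := add_mem (JJ_act K hxK (h2 hyK).2) (h1 hxK).2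
          rw [orthAct_mul_apply]
          simpa using this
        | inv x hx h =>
          have hxK : x ∈ K := by rw [hrefl]; exact hx
          refine ⟨hgK, ?_⟩
          have := neg_mem (JJ_act K hgK (h hxK).2)
          rw [map_sub, ← orthAct_mul_apply, inv_mul_cancel, orthAct_one] at this
          simpa using this
      exact this.2
    have := Fintype.ofFinite K
    let A : MvPolynomial (Fin n) ℂ → MvPolynomial (Fin n) ℂ := fun p => ∑ g : K, orthAct g.1 p
    have hAinv : ∀ p, A p ∈ orthInv K := by
      intro p
      rw [mem_orthInv]
      intro g hg
      simp only [A, map_sum, ← orthAct_mul_apply]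
      exact Fintype.sum_equiv (Equiv.mulLeft (⟨g, hg⟩ : K)) _ _ (fun x => rfl)
    have hAmul : ∀ a ∈ orthInv K, ∀ p, A (a * p) = a * A p := by
      intro a ha p
      simp only [A, map_mul, Finset.mul_sum]
      exact Finset.sum_congr rfl fun g _ => by rw [(mem_orthInv K).1 ha g g.2]
    have hA0 : coeff 0 (A p₀) = 0 := by
      by_contra hne
      apply hnot (A p₀) (hAinv _) hne (fun i => - A (p i)) (fun i => neg_mem (hAinv _))
      have hA : A (f₀ * p₀ + ∑ i ∈ s, f i * p i) = 0 := by rw [hsum]; simp [A]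
      have hAadd : A (f₀ * p₀ + ∑ i ∈ s, f i * p i) = A (f₀ * p₀) + ∑ i ∈ s, A (f i * p i) := by
        simp only [A, map_add, map_sum, Finset.sum_add_distrib]
        rw [Finset.sum_comm]
      rw [hAadd, hAmul _ hf₀, Finset.sum_congr rfl (fun i _ => hAmul _ (hf i) (p i))] at hA
      have e : ∑ i ∈ s, -A (p i) * f i = - ∑ i ∈ s, f i * A (p i) := by
        rw [← Finset.sum_neg_distrib]
        exact Finset.sum_congr rfl fun i _ => by ring
      rw [e]
      linear_combination hA
    have h5 : A p₀ ∈ JJ K := Iplus_le_JJ K ((mem_Iplus K).2 ⟨hAinv _, hA0⟩)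
    have h6 : A p₀ - (Fintype.card K : ℂ) • p₀ ∈ JJ K := by
      have : A p₀ - (Fintype.card K : ℂ) • p₀ = ∑ g : K, (orthAct g.1 p₀ - p₀) := by
        simp [A, Finset.sum_sub_distrib, MvPolynomial.smul_eq_C_mul]
      rw [this]
      exact Submodule.sum_mem _ fun g _ => hall g g.2
    have h7 : (Fintype.card K : ℂ) • p₀ ∈ JJ K := by
      have := sub_mem h5 h6
      simpa using this
    exact (Submodule.smul_mem_iff _ (by simp [Fintype.card_ne_zero])).1 h7

lemma sub_C_mem (u : MvPolynomial (Fin n) ℂ) (hu : u ∈ orthInv K) (h : MvPolynomial (Fin n) ℂ) :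
    u * h - coeff 0 u • h ∈ JJ K := by
  have : u - MvPolynomial.C (coeff 0 u) ∈ Iplus K := by
    rw [mem_Iplus]
    refine ⟨sub_mem hu ?_, by simp⟩
    rw [mem_orthInv]
    intro g _
    rw [← MvPolynomial.algebraMap_eq, AlgHom.commutes]
  have h2 := mul_mem_JJ K h (Iplus_le_JJ K this)
  rw [MvPolynomial.smul_eq_C_mul]
  convert h2 using 1
  ring

lemma indep
    (hrefl : K = Subgroup.closure
      {g : Matrix.orthogonalGroup (Fin n) ℝ | g ∈ K ∧ IsPseudoReflection g})
    {ι : Type*} (s : Finset ι) (f : ι → MvPolynomial (Fin n) ℂ) (hf : ∀ i, f i ∈ orthInv K) :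
    ∀ p : ι → MvPolynomial (Fin n) ℂ,
      (∀ c : ι → ℂ, ∑ i ∈ s, c i • p i ∈ JJ K → ∀ i ∈ s, c i = 0) →
      ∑ i ∈ s, f i * p i = 0 → ∀ i ∈ s, f i = 0 := by
  classical
  induction s using Finset.induction_on with
  | empty => simp
  | insert k s hk ih =>
    intro p hp hsum
    rw [Finset.sum_insert hk] at hsum
    have hpk : p k ∉ JJ K := by
      intro h
      have := hp (Pi.single k 1) (by
        rw [Finset.sum_insert hk, Finset.sum_eq_zero]
        · simpa using h
        · intro i hi
          have : i ≠ k := fun e => hk (e ▸ hi)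
          simp [this]) k (by simp)
      simp at this
    have hex : ∃ u ∈ orthInv K, coeff 0 u ≠ 0 ∧ ∃ a : ι → MvPolynomial (Fin n) ℂ,
        (∀ i, a i ∈ orthInv K) ∧ u * f k = ∑ i ∈ s, a i * f i := by
      by_contra hcon
      push Not at hcon
      exact hpk (chevalley K hrefl s (f k) f (hf k) hf hcon _ (p k) p (Nat.lt_succ_self _) hsum)
    obtain ⟨u, hu, hu0, a, ha, hua⟩ := hex
    have hs : ∀ i ∈ s, f i = 0 := by
      apply ih (fun i => u * p i + a i * p k)
      · intro c hc
        have h1 : ∑ i ∈ s, c i • (coeff 0 u • p i + coeff 0 (a i) • p k) ∈ JJ K := by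
          have h2 : ∑ i ∈ s, c i • ((u * p i - coeff 0 u • p i) +
              (a i * p k - coeff 0 (a i) • p k)) ∈ JJ K :=
            Submodule.sum_mem _ fun i _ => Submodule.smul_mem _ _
              (add_mem (sub_C_mem K u hu _) (sub_C_mem K _ (ha i) _))
          have := sub_mem hc h2
          rw [← Finset.sum_sub_distrib] at this
          convert this using 2 with i _
          rw [← smul_sub]; congr 1; abel
        let c' : ι → ℂ := fun i => if i = k then ∑ j ∈ s, c j * coeff 0 (a j) else c i * coeff 0 u
        have h3 := hp c' (by
          rw [Finset.sum_insert hk]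
          convert h1 using 1
          simp only [smul_add, smul_smul, Finset.sum_add_distrib, ← Finset.sum_smul]
          rw [add_comm]
          congr 1
          · refine Finset.sum_congr rfl fun i hi => ?_
            have : i ≠ k := fun e => hk (e ▸ hi)
            simp [c', this]
          · simp [c'])
        intro i hi
        have h4 := h3 i (by simp [hi])
        have : i ≠ k := fun e => hk (e ▸ hi)
        simpa [c', this, hu0] using h4
      · have e : ∑ i ∈ s, f i * (u * p i + a i * p k) =
            u * ∑ i ∈ s, f i * p i + (∑ i ∈ s, a i * f i) * p k := by
          rw [Finset.mul_sum, Finset.sum_mul, ← Finset.sum_add_distrib]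
          exact Finset.sum_congr rfl fun i _ => by ring
        rw [e, ← hua]
        linear_combination u * hsum
    intro i hi
    rcases Finset.mem_insert.1 hi with rfl | hi
    · rw [Finset.sum_eq_zero (fun j hj => by rw [hs j hj, zero_mul]), add_zero] at hsum
      refine (mul_eq_zero.1 hsum).resolve_right ?_
      intro h
      exact hpk (h ▸ zero_mem _)
    · exact hs i hi

lemma disj
    (hrefl : K = Subgroup.closure
      {g : Matrix.orthogonalGroup (Fin n) ℝ | g ∈ K ∧ IsPseudoReflection g}) :
    (orthInv K).LinearDisjoint (harmonicSubmodule K) := by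
  let b := Module.Basis.ofVectorSpace ℂ (harmonicSubmodule K)
  apply Submodule.LinearDisjoint.of_basis_right' _ _ b
  suffices h0 : ∀ m, Submodule.mulRightMap (orthInv K) b m = 0 → m = 0 by
    intro m m' h
    have e : Submodule.mulRightMap (orthInv K) b (m - m') + Submodule.mulRightMap (orthInv K) b m'
        = Submodule.mulRightMap (orthInv K) b m := by
      rw [← LinearMap.map_add]
      exact congrArg _ (sub_add_cancel m m')
    rw [h] at e
    exact sub_eq_zero.1 (h0 _ (left_eq_add.1 (by rw [add_comm]; exact e.symm)))
  intro m hm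
  rw [Submodule.mulRightMap_apply, Finsupp.sum] at hm
  have := indep K hrefl m.support (fun i => (m i : MvPolynomial (Fin n) ℂ)) (fun i => (m i).2)
    (fun i => (b i : MvPolynomial (Fin n) ℂ)) (by
      intro c hc
      have h1 : ((∑ i ∈ m.support, c i • b i : harmonicSubmodule K) : MvPolynomial (Fin n) ℂ)
          ∈ JJ K := by simpa using hc
      have h2 := harm_inf_JJ K (Subtype.mem _) h1
      have h3 : ∑ i ∈ m.support, c i • b i = 0 := Subtype.ext h2
      exact linearIndependent_iff'.1 b.linearIndependent _ _ h3) hm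
  ext1 i
  by_cases hi : i ∈ m.support
  · exact Subtype.ext (this i hi)
  · simpa using hi

end chev

/-- For a finite pseudo-reflection group `K ≤ O(n)`, the multiplication
map `j ⊗ h ↦ j·h` extends to a linear bijection of `I ⊗ H` onto `S = ℂ[x₁,…,xₙ]`,
where `I` is the invariant ring and `H` the space of `K`-harmonic polynomials. -/
theorem stmt12 (n : ℕ) (K : Subgroup (Matrix.orthogonalGroup (Fin n) ℝ)) [Finite K]
    (hrefl : K = Subgroup.closure
      {g : Matrix.orthogonalGroup (Fin n) ℝ | g ∈ K ∧ IsPseudoReflection g}) :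
    ∃ F : (orthInv K ⊗[ℂ] harmonicSubmodule K) ≃ₗ[ℂ] MvPolynomial (Fin n) ℂ,
      ∀ (j : orthInv K) (h : harmonicSubmodule K),
        F (j ⊗ₜ[ℂ] h) = (j : MvPolynomial (Fin n) ℂ) * (h : MvPolynomial (Fin n) ℂ) := by
  refine ⟨LinearEquiv.ofBijective (Submodule.mulMap (orthInv K) (harmonicSubmodule K))
    ⟨(disj K hrefl).injective, ?_⟩, fun j h => rfl⟩
  rw [← LinearMap.range_eq_top, Submodule.mulMap_range, surj_mul]

end
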